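/- Let L ∈ B(H,G) satisfy 0 < ‖L‖ ≤ 1, let g : G → (−∞,+∞] be proper with a continuous affine minorant, and let γ > 0. Then the recession function of the proximal cocomposition satisfies rec(L ⊚_γ g) = (rec(g**)) ∘ L. -/

import Mathlib

open scoped RealInnerProductSpace
open Filter Set

noncomputable section

/-- Fenchel (Legendre) conjugate of an extended-real-valued function. -/
def fconj {H : Type*} [NormedAddCommGroup H] [InnerProductSpace ℝ H]
    (f : H → EReal) : H → EReal :=
  fun xs => ⨆ x : H, (⟪x, xs⟫ : EReal) - f x

/-- Moreau envelope of index `γ`. -/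
def menv {H : Type*} [NormedAddCommGroup H] (γ : ℝ) (f : H → EReal) : H → EReal :=
  fun x => ⨅ y : H, f y + ((‖x - y‖ ^ 2 / (2 * γ) : ℝ) : EReal)

/-- Quadratic kernel `Q`. -/
def qk {H : Type*} [NormedAddCommGroup H] (x : H) : ℝ := ‖x‖ ^ 2 / 2

/-- Proximal composition `L ⊙_γ g`. -/
def proxComp {H G : Type*} [NormedAddCommGroup H] [InnerProductSpace ℝ H]
    [NormedAddCommGroup G] [InnerProductSpace ℝ G]
    (L : H →L[ℝ] G) (γ : ℝ) (g : G → EReal) : H → EReal :=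
  fun x => fconj (fun z => menv (1 / γ) (fconj g) (L z)) x - (((1 / γ) * qk x : ℝ) : EReal)

/-- Proximal cocomposition `L ⊚_γ g`. -/
def proxCocomp {H G : Type*} [NormedAddCommGroup H] [InnerProductSpace ℝ H]
    [NormedAddCommGroup G] [InnerProductSpace ℝ G]
    (L : H →L[ℝ] G) (γ : ℝ) (g : G → EReal) : H → EReal :=
  fconj (proxComp L (1 / γ) (fconj g))

/-- `f` is proper: not identically `+∞` and never `−∞`. -/
def ProperE {H : Type*} (f : H → EReal) : Prop :=
  (∃ x, f x ≠ ⊤) ∧ ∀ x, f x ≠ ⊥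

/-- `f` admits a continuous affine minorant. -/
def HasAffMinorant {H : Type*} [NormedAddCommGroup H] [InnerProductSpace ℝ H]
    (f : H → EReal) : Prop :=
  ∃ (u : H) (c : ℝ), ∀ x, ((⟪x, u⟫ + c : ℝ) : EReal) ≤ f x

/-- Convexity for extended-real-valued functions. -/
def ConvexE {H : Type*} [NormedAddCommGroup H] [InnerProductSpace ℝ H]
    (f : H → EReal) : Prop :=
  ∀ x y : H, ∀ a b : ℝ, 0 < a → 0 < b → a + b = 1 →
    f (a • x + b • y) ≤ ((a : ℝ) : EReal) * f x + ((b : ℝ) : EReal) * f y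

/-- The class `Γ₀`: proper, lower semicontinuous, convex. -/
def IsGamma0 {H : Type*} [NormedAddCommGroup H] [InnerProductSpace ℝ H]
    (f : H → EReal) : Prop :=
  ProperE f ∧ LowerSemicontinuous f ∧ ConvexE f

/-- `p` is a proximal point of `f` at `x`. -/
def IsProx {H : Type*} [NormedAddCommGroup H] (f : H → EReal) (x p : H) : Prop :=
  ∀ y : H, f p + ((‖x - p‖ ^ 2 / 2 : ℝ) : EReal) ≤ f y + ((‖x - y‖ ^ 2 / 2 : ℝ) : EReal)

/-- Subdifferential. -/
def SubdiffE {H : Type*} [NormedAddCommGroup H] [InnerProductSpace ℝ H]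
    (f : H → EReal) (x : H) : Set H :=
  {xs | ∀ y : H, (⟪y - x, xs⟫ : EReal) + f x ≤ f y}

/-- Recession function. -/
def recE {H : Type*} [NormedAddCommGroup H] (f : H → EReal) : H → EReal :=
  fun x => ⨆ y : {y : H // f y ≠ ⊤}, f (x + (y : H)) - f (y : H)

end

section

variable {H G : Type*} [NormedAddCommGroup H] [InnerProductSpace ℝ H]
  [NormedAddCommGroup G] [InnerProductSpace ℝ G]

theorem le_of_forall_nat_add_mul_le {a b c r : ℝ} (h : ∀ n : ℕ, a + n * b ≤ c + n * r) :
    b ≤ r := by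
  by_contra! hlt
  obtain ⟨n, hn⟩ := exists_nat_gt ((c - a) / (b - r))
  rw [div_lt_iff₀ (sub_pos.2 hlt)] at hn
  linarith [h n]

/-- Fenchel–Young inequality at points where the function is bounded above. -/
theorem coe_inner_sub_le_fconj {F : H → EReal} {u : H} {p : ℝ} (h : F u ≤ p) (x : H) :
    ((⟪u, x⟫ - p : ℝ) : EReal) ≤ fconj F x := by
  rw [EReal.coe_sub]
  exact (EReal.sub_le_sub le_rfl h).trans (le_iSup (fun y : H => (⟪y, x⟫ : EReal) - F y) u)

theorem fconj_ne_bot {F : H → EReal} {u : H} (h : F u ≠ ⊤) (x : H) : fconj F x ≠ ⊥ :=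
  ne_bot_of_le_ne_bot (EReal.coe_ne_bot _)
    (coe_inner_sub_le_fconj (EReal.le_coe_toReal h) x)

theorem fconj_le_coe {F : H → EReal} {x : H} {c : ℝ} (h : ∀ y, ((⟪y, x⟫ - c : ℝ) : EReal) ≤ F y) :
    fconj F x ≤ c := by
  refine iSup_le fun y => ?_
  refine (EReal.sub_le_sub le_rfl (h y)).trans ?_
  rw [← EReal.coe_sub, EReal.coe_le_coe_iff]
  linarith

theorem coe_le_of_fconj_le {F : H → EReal} {x : H} {c : ℝ} (h : fconj F x ≤ c) (y : H) :
    ((⟪y, x⟫ - c : ℝ) : EReal) ≤ F y := by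
  have h' : (⟪y, x⟫ : EReal) - F y ≤ c :=
    (le_iSup (fun y : H => (⟪y, x⟫ : EReal) - F y) y).trans h
  induction hF : F y with
  | bot => simp [hF] at h'
  | top => exact le_top
  | coe t =>
    rw [hF, ← EReal.coe_sub, EReal.coe_le_coe_iff] at h'
    rw [EReal.coe_le_coe_iff]
    linarith

theorem fconj_fconj_le (F : H → EReal) (x : H) : fconj (fconj F) x ≤ F x := by
  refine iSup_le fun y => ?_
  induction hF : fconj F y with
  | bot =>
    have h : (⟪x, y⟫ : EReal) - F x ≤ ⊥ :=
      hF ▸ le_iSup (fun z : H => (⟪z, y⟫ : EReal) - F z) x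
    induction hx : F x with
    | bot => simp [hx] at h
    | top => exact le_top
    | coe t => simp [hx, ← EReal.coe_sub] at h
  | top => simp
  | coe c =>
    rw [← EReal.coe_sub, real_inner_comm]
    exact coe_le_of_fconj_le hF.le x

/-- The recession function of a conjugate is at most the support function of the domain. -/
theorem recE_fconj_le {F : H → EReal} (hF : ∀ u, F u ≠ ⊥) {x : H} {r : ℝ}
    (h : ∀ u, F u ≠ ⊤ → ⟪u, x⟫ ≤ r) : recE (fconj F) x ≤ r := by
  refine iSup_le fun y => EReal.sub_le_of_le_add (iSup_le fun u => ?_)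
  induction hu : F u with
  | bot => exact absurd hu (hF u)
  | top => simp
  | coe p =>
    calc (⟪u, x + (y : H)⟫ : EReal) - p ≤ ((r + (⟪u, (y : H)⟫ - p) : ℝ) : EReal) := by
          rw [← EReal.coe_sub, EReal.coe_le_coe_iff, inner_add_right]
          linarith [h u (by simp [hu])]
      _ ≤ r + fconj F y := by
          rw [EReal.coe_add]
          gcongr
          exact coe_inner_sub_le_fconj hu.le _

theorem le_add_nat_mul_of_recE_le {f : H → EReal} (hf : ∀ y, f y ≠ ⊥) {x y : H} {c r : ℝ}
    (hr : recE f x ≤ r) (hy : f y ≤ c) (n : ℕ) :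
    f ((n : ℝ) • x + y) ≤ ((c + n * r : ℝ) : EReal) := by
  induction n with
  | zero => simpa using hy
  | succ n ih =>
    have hne : f ((n : ℝ) • x + y) ≠ ⊤ := ne_top_of_le_ne_top (EReal.coe_ne_top _) ih
    have h : f (x + ((n : ℝ) • x + y)) - f ((n : ℝ) • x + y) ≤ r :=
      (le_iSup (fun z : {z : H // f z ≠ ⊤} => f (x + (z : H)) - f (z : H)) ⟨_, hne⟩).trans hr
    rw [EReal.sub_le_iff_le_add (.inl (hf _)) (.inl hne)] at h
    have hx : ((n + 1 : ℕ) : ℝ) • x + y = x + ((n : ℝ) • x + y) := by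
      push_cast
      module
    rw [hx]
    calc _ ≤ _ := h
      _ ≤ (r : EReal) + ((c + n * r : ℝ) : EReal) := by gcongr
      _ = _ := by
        rw [← EReal.coe_add, Nat.cast_succ]
        congr 1
        ring

theorem menv_le {E : Type*} [NormedAddCommGroup E] {γ : ℝ} {k : E → EReal} {w : E} {c : ℝ}
    (h : k w ≤ c) (q : E) :
    menv γ k q ≤ ((c + ‖q - w‖ ^ 2 / (2 * γ) : ℝ) : EReal) := by
  rw [EReal.coe_add]
  exact (iInf_le _ w).trans (by gcongr)

/-- An affine minorant of `k` yields an affine minorant of its Moreau envelope. -/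
theorem coe_le_menv {γ : ℝ} (hγ : 0 < γ) {k : G → EReal} {v : G} {c : ℝ}
    (h : ∀ w, ((⟪w, v⟫ - c : ℝ) : EReal) ≤ k w) (q : G) :
    ((⟪q, v⟫ - (c + γ * ‖v‖ ^ 2 / 2) : ℝ) : EReal) ≤ menv γ k q := by
  refine le_iInf fun w => ?_
  calc ((⟪q, v⟫ - (c + γ * ‖v‖ ^ 2 / 2) : ℝ) : EReal)
      ≤ ((⟪w, v⟫ - c + ‖q - w‖ ^ 2 / (2 * γ) : ℝ) : EReal) := by
        rw [EReal.coe_le_coe_iff]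
        have h1 : ⟪q, v⟫ - ⟪w, v⟫ ≤ ‖q - w‖ * ‖v‖ := by
          rw [← inner_sub_left]
          exact real_inner_le_norm _ _
        have h2 : ‖q - w‖ ^ 2 / (2 * γ) + γ * ‖v‖ ^ 2 / 2 - ‖q - w‖ * ‖v‖
            = (‖q - w‖ - γ * ‖v‖) ^ 2 / (2 * γ) := by
          field_simp
          ring
        have h3 : 0 ≤ (‖q - w‖ - γ * ‖v‖) ^ 2 / (2 * γ) := by positivity
        linarith
    _ ≤ _ := by
        rw [EReal.coe_add]
        gcongr
        exact h w

theorem sub_coe_ne_bot {a : EReal} (h : a ≠ ⊥) (t : ℝ) : a - t ≠ ⊥ := by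
  induction a with
  | bot => exact absurd rfl h
  | top => simp
  | coe s => exact EReal.coe_ne_bot _

theorem ne_top_of_sub_coe_ne_top {a : EReal} {t : ℝ} (h : a - t ≠ ⊤) : a ≠ ⊤ := by
  rintro rfl
  simp at h

end

/-- Recession function of the proximal cocomposition: `rec(L ⊚_γ g) = (rec g**) ∘ L`. -/
theorem recE_proxCocomp
    {H G : Type*} [NormedAddCommGroup H] [InnerProductSpace ℝ H] [CompleteSpace H]
    [NormedAddCommGroup G] [InnerProductSpace ℝ G] [CompleteSpace G]
    (L : H →L[ℝ] G) (hL0 : 0 < ‖L‖) (hL1 : ‖L‖ ≤ 1)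
    (g : G → EReal) (hg : ProperE g) (hm : HasAffMinorant g)
    (γ : ℝ) (hγ : 0 < γ) :
    recE (proxCocomp L γ g) = fun x : H => recE (fconj (fconj g)) (L x) := by
  obtain ⟨⟨w, hw⟩, -⟩ := hg
  obtain ⟨v₀, c₀, hm⟩ := hm
  have hv₀ : fconj g v₀ ≤ ((-c₀ : ℝ) : EReal) :=
    fconj_le_coe fun y => by simpa using hm y
  have hh : ∀ v, fconj g v ≠ ⊥ := fconj_ne_bot hw
  set k := fconj (fconj g) with hk
  have hk_bot : ∀ q, k q ≠ ⊥ :=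
    fconj_ne_bot (ne_top_of_le_ne_top (EReal.coe_ne_top _) hv₀)
  obtain ⟨c, hc⟩ : ∃ c : ℝ, k w ≤ c :=
    ⟨_, (fconj_fconj_le g w).trans (EReal.le_coe_toReal hw)⟩
  set φ : H → EReal := fun z => menv γ k (L z) with hφ
  set P : H → EReal := fun u => fconj φ u - ((γ * qk u : ℝ) : EReal) with hP
  have hf : proxCocomp L γ g = fconj P := by
    simp only [proxCocomp, hP, hφ, hk]
    congr 1
    funext u
    simp only [proxComp, one_div_one_div]
  rw [hf]
  have hφ_top : φ 0 ≠ ⊤ := ne_top_of_le_ne_top (EReal.coe_ne_top _) (menv_le hc _)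
  have hP_bot : ∀ u, P u ≠ ⊥ := fun u => sub_coe_ne_bot (fconj_ne_bot hφ_top u) _
  -- The conjugate of `g` bounds `P` along the adjoint of `L`.
  have hP_le : ∀ (v : G) (d : ℝ), fconj g v ≤ d →
      P (L.adjoint v) ≤ ((d + γ * ‖v‖ ^ 2 / 2 - γ * qk (L.adjoint v) : ℝ) : EReal) := by
    intro v d hd
    rw [EReal.coe_sub]
    refine EReal.sub_le_sub (fconj_le_coe fun z => ?_) le_rfl
    rw [ContinuousLinearMap.adjoint_inner_right]
    refine coe_le_menv hγ (fun q => ?_) _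
    rw [real_inner_comm]
    exact coe_inner_sub_le_fconj hd q
  have hf_bot : ∀ y, fconj P y ≠ ⊥ :=
    fconj_ne_bot (ne_top_of_le_ne_top (EReal.coe_ne_top _) (hP_le v₀ _ hv₀))
  -- The domain of the cocomposition contains the image of that of `k` under the adjoint.
  obtain ⟨b, hb⟩ : ∃ b : ℝ, fconj P (L.adjoint w) ≤ b := by
    refine ⟨c + ‖w‖ ^ 2 / (2 * γ), fconj_le_coe fun u => ?_⟩
    set z : H := L.adjoint w + γ • u with hz
    have h := coe_inner_sub_le_fconj (F := φ) (menv_le hc (L z)) u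
    calc _ ≤ ((⟪z, u⟫ - (c + ‖L z - w‖ ^ 2 / (2 * γ)) - γ * qk u : ℝ) : EReal) := by
          rw [EReal.coe_le_coe_iff]
          have h1 : ‖L z - w‖ ^ 2 ≤ ‖z‖ ^ 2 - 2 * ⟪z, L.adjoint w⟫ + ‖w‖ ^ 2 := by
            rw [norm_sub_sq_real, ContinuousLinearMap.adjoint_inner_right]
            have : ‖L z‖ ≤ ‖z‖ := L.le_of_opNorm_le hL1 z |>.trans_eq (one_mul _)
            gcongr
          have h2 : ‖z‖ ^ 2 - 2 * ⟪z, L.adjoint w⟫ = γ ^ 2 * ‖u‖ ^ 2 - ‖L.adjoint w‖ ^ 2 := by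
            rw [hz, norm_add_sq_real, inner_add_left, real_inner_smul_left, real_inner_smul_right,
              norm_smul, real_inner_self_eq_norm_sq, real_inner_comm u, Real.norm_of_nonneg hγ.le]
            ring
          have h3 : ⟪z, u⟫ = ⟪u, L.adjoint w⟫ + γ * ‖u‖ ^ 2 := by
            rw [hz, inner_add_left, real_inner_smul_left, real_inner_self_eq_norm_sq,
              real_inner_comm u]
          have h4 : ‖L z - w‖ ^ 2 / (2 * γ) ≤ (γ ^ 2 * ‖u‖ ^ 2 + ‖w‖ ^ 2) / (2 * γ) := by
            gcongr
            nlinarith [sq_nonneg ‖L.adjoint w‖]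
          have h5 : (γ ^ 2 * ‖u‖ ^ 2 + ‖w‖ ^ 2) / (2 * γ)
              = γ * ‖u‖ ^ 2 / 2 + ‖w‖ ^ 2 / (2 * γ) := by
            field_simp
          rw [h3, qk]
          linarith
      _ ≤ P u := by
          rw [EReal.coe_sub]
          exact EReal.sub_le_sub h le_rfl
  funext x
  apply le_antisymm
  · refine (EReal.le_of_forall_lt_iff_le).1 fun r hr => recE_fconj_le hP_bot fun u hu => ?_
    have hu' := EReal.le_coe_toReal (ne_top_of_sub_coe_ne_top hu)
    refine le_of_forall_nat_add_mul_le (a := -(fconj φ u).toReal)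
      (c := c + ‖w‖ ^ 2 / (2 * γ)) fun n => ?_
    have h1 := coe_le_of_fconj_le hu' ((n : ℝ) • x)
    have h2 := menv_le (γ := γ) (le_add_nat_mul_of_recE_le hk_bot hr.le hc n) (L ((n : ℝ) • x))
    have h3 := EReal.coe_le_coe_iff.1 (h1.trans h2)
    rw [map_smul, sub_add_cancel_left, norm_neg, real_inner_smul_left, real_inner_comm] at h3
    linarith
  · refine (EReal.le_of_forall_lt_iff_le).1 fun r hr => recE_fconj_le hh fun v hv => ?_
    have hPv := hP_le v _ (EReal.le_coe_toReal hv)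
    set p := (fconj g v).toReal + γ * ‖v‖ ^ 2 / 2 - γ * qk (L.adjoint v)
    refine le_of_forall_nat_add_mul_le (a := ⟪L.adjoint v, L.adjoint w⟫ - p) (c := b) fun n => ?_
    have h := EReal.coe_le_coe_iff.1 ((coe_inner_sub_le_fconj hPv ((n : ℝ) • x + L.adjoint w)).trans
      (le_add_nat_mul_of_recE_le hf_bot hr.le hb n))
    rw [inner_add_right, real_inner_smul_right, ContinuousLinearMap.adjoint_inner_left L x v] at h
    linarith
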